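/- arXiv:1902.02739 — 3 statements merged into one kernel-verified Lean document; each statement's English description precedes it below -/
import Mathlib

section
/- Let $a : \mathbb{R} \to \mathbb{R}$, let $u, v : \mathbb{R} \to \mathbb{R}$ be twice differentiable functions satisfying $u''(x) + a(x)u(x) = 0$ and $v''(x) + a(x)v(x) = 0$ for all $x$, and let $c \in \mathbb{R}$. Suppose $u(x)^2 - c\,v(x)^2 > 0$ for all $x$ in an open interval $I$, and define $y(x) = \sqrt{u(x)^2 - c\,v(x)^2}$ on $I$. Then for every $x \in I$, $y$ is twice differentiable at $x$ and $y''(x) + a(x)y(x) + \dfrac{c}{y(x)^3} = -c\,\dfrac{\left(u'(x)v(x) - u(x)v'(x)\right)^2 - 1}{y(x)^3}$. -/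
/-- If `u, v` are twice differentiable solutions of `y'' + a x * y = 0`
on all of `ℝ`, `c : ℝ`, and `u x ^ 2 - c * v x ^ 2 > 0` on an open interval
`I = Ioo α β`, then `y x = √(u x ^ 2 - c * v x ^ 2)` is twice differentiable at each
`x ∈ I` and satisfies
`y'' x + a x * y x + c / y x ^ 3 = -c * ((u' x * v x - u x * v' x) ^ 2 - 1) / y x ^ 3`. -/
theorem stmt_0 (a u v u' u'' v' v'' : ℝ → ℝ) (c α β : ℝ)
    (hu1 : ∀ x, HasDerivAt u (u' x) x) (hu2 : ∀ x, HasDerivAt u' (u'' x) x)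
    (hv1 : ∀ x, HasDerivAt v (v' x) x) (hv2 : ∀ x, HasDerivAt v' (v'' x) x)
    (huode : ∀ x, u'' x + a x * u x = 0) (hvode : ∀ x, v'' x + a x * v x = 0)
    (hpos : ∀ x ∈ Set.Ioo α β, 0 < u x ^ 2 - c * v x ^ 2)
    (y : ℝ → ℝ) (hy : ∀ x, y x = Real.sqrt (u x ^ 2 - c * v x ^ 2)) :
    ∀ x ∈ Set.Ioo α β,
      DifferentiableAt ℝ y x ∧ DifferentiableAt ℝ (deriv y) x ∧
      deriv (deriv y) x + a x * y x + c / y x ^ 3 =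
        -c * ((u' x * v x - u x * v' x) ^ 2 - 1) / y x ^ 3 := by
  have hypos : ∀ x ∈ Set.Ioo α β, 0 < y x := by
    intro x hx
    rw [hy]
    exact Real.sqrt_pos.mpr (hpos x hx)
  have hsq : ∀ x ∈ Set.Ioo α β, y x ^ 2 = u x ^ 2 - c * v x ^ 2 := by
    intro x hx
    rw [hy]
    exact Real.sq_sqrt (hpos x hx).le
  have hfun : y = fun x => Real.sqrt (u x ^ 2 - c * v x ^ 2) := funext hy
  have hd : ∀ x ∈ Set.Ioo α β,
      HasDerivAt y ((u x * u' x - c * (v x * v' x)) / y x) x := by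
    intro x hx
    have h1 := (((hu1 x).pow 2).sub (((hv1 x).pow 2).const_mul c)).sqrt (hpos x hx).ne'
    have h2 := h1.congr_of_eventuallyEq (f₁ := y) (Filter.Eventually.of_forall hy)
    have hne := (hypos x hx).ne'
    refine h2.congr_deriv ?_
    change _ / (2 * Real.sqrt (u x ^ 2 - c * v x ^ 2)) = _
    rw [← hy x]
    field_simp
    push_cast
    ring
  intro x hx
  have hev : deriv y =ᶠ[nhds x] fun t => (u t * u' t - c * (v t * v' t)) / y t := by
    filter_upwards [isOpen_Ioo.mem_nhds hx] with t ht
    exact (hd t ht).deriv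
  have hne := (hypos x hx).ne'
  have hdd := (((((hu1 x).mul (hu2 x)).sub
    (((hv1 x).mul (hv2 x)).const_mul c)).div (hd x hx) hne)).congr_of_eventuallyEq hev
  refine ⟨(hd x hx).differentiableAt, hdd.differentiableAt, ?_⟩
  rw [hdd.deriv]
  have e1 : u'' x = -(a x * u x) := by linarith [huode x]
  have e2 : v'' x = -(a x * v x) := by linarith [hvode x]
  have e3 := hsq x hx
  simp only [Pi.sub_apply, Pi.mul_apply, e1, e2]
  generalize y x = Y at *
  field_simp
  have e4 : Y ^ 4 = (u x ^ 2 - c * v x ^ 2) ^ 2 := by rw [← e3]; ring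
  ring_nf
  simp only [e4, e3]
  ring
end

section
/- (Pinney's theorem.) Let $a : \mathbb{R} \to \mathbb{R}$, let $c \in \mathbb{R}$, and let $u, v : \mathbb{R} \to \mathbb{R}$ be twice differentiable functions satisfying $u''(x) + a(x)u(x) = 0$ and $v''(x) + a(x)v(x) = 0$ for all $x$, whose Wronskian satisfies $u'(x)v(x) - u(x)v'(x) = 1$ for all $x$. Suppose $u(x)^2 - c\,v(x)^2 > 0$ for all $x$ in an open interval $I$. Then the function $y(x) = \sqrt{u(x)^2 - c\,v(x)^2}$ is twice differentiable on $I$ and satisfies Pinney's equation $y''(x) + a(x)y(x) + \dfrac{c}{y(x)^3} = 0$ for all $x \in I$. -/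
/-- Pinney's theorem: If `u, v` are twice differentiable solutions of
`y'' + a x * y = 0` on `ℝ` with Wronskian `u' x * v x - u x * v' x = 1` for all `x`,
and `u x ^ 2 - c * v x ^ 2 > 0` on the open interval `I = Ioo α β`, then
`y x = √(u x ^ 2 - c * v x ^ 2)` is twice differentiable on `I` and satisfies
Pinney's equation `y'' x + a x * y x + c / y x ^ 3 = 0` on `I`. -/
theorem stmt_1 (a u v u' u'' v' v'' : ℝ → ℝ) (c α β : ℝ)
    (hu1 : ∀ x, HasDerivAt u (u' x) x) (hu2 : ∀ x, HasDerivAt u' (u'' x) x)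
    (hv1 : ∀ x, HasDerivAt v (v' x) x) (hv2 : ∀ x, HasDerivAt v' (v'' x) x)
    (huode : ∀ x, u'' x + a x * u x = 0) (hvode : ∀ x, v'' x + a x * v x = 0)
    (hwr : ∀ x, u' x * v x - u x * v' x = 1)
    (hpos : ∀ x ∈ Set.Ioo α β, 0 < u x ^ 2 - c * v x ^ 2)
    (y : ℝ → ℝ) (hy : ∀ x, y x = Real.sqrt (u x ^ 2 - c * v x ^ 2)) :
    ∀ x ∈ Set.Ioo α β,
      DifferentiableAt ℝ y x ∧ DifferentiableAt ℝ (deriv y) x ∧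
      deriv (deriv y) x + a x * y x + c / y x ^ 3 = 0 := by
  have hyf : y = fun x => Real.sqrt (u x ^ 2 - c * v x ^ 2) := funext hy
  have hypos : ∀ x ∈ Set.Ioo α β, 0 < y x := by
    intro x hx
    rw [hy]
    exact Real.sqrt_pos.2 (hpos x hx)
  have h1 : ∀ x ∈ Set.Ioo α β,
      HasDerivAt y ((u x * u' x - c * (v x * v' x)) / y x) x := by
    intro x hx
    have h := (((hu1 x).fun_pow 2).fun_sub (((hv1 x).fun_pow 2).const_mul c)).sqrt (hpos x hx).ne'
    rw [← hyf, ← hy x] at h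
    have h0 := (hypos x hx).ne'
    refine h.congr_deriv ?_
    field_simp
    norm_num
    ring
  intro x hx
  have h0 := (hypos x hx).ne'
  have hev : deriv y =ᶠ[nhds x] fun x => (u x * u' x - c * (v x * v' x)) / y x := by
    filter_upwards [isOpen_Ioo.mem_nhds hx] with z hz
    exact (h1 z hz).deriv
  have h2 := (((((hu1 x).fun_mul (hu2 x)).fun_sub
    (((hv1 x).fun_mul (hv2 x)).const_mul c)).fun_div (h1 x hx) h0).congr_of_eventuallyEq hev)
  refine ⟨(h1 x hx).differentiableAt, h2.differentiableAt, ?_⟩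
  rw [h2.deriv]
  have hsq : y x ^ 2 = u x ^ 2 - c * v x ^ 2 := by
    rw [hy]
    exact Real.sq_sqrt (hpos x hx).le
  have e1 : u'' x = -(a x * u x) := by linarith [huode x]
  have e2 : v'' x = -(a x * v x) := by linarith [hvode x]
  have hw := hwr x
  rw [e1, e2]
  generalize y x = Y at *
  generalize u x = U at *
  generalize v x = V at *
  generalize u' x = P at *
  generalize v' x = Q at *
  generalize a x = A at *
  have key : (P * P + U * -(A * U) - c * (Q * Q + V * -(A * V))) * Y ^ 2
      - (U * P - c * (V * Q)) ^ 2 + A * (Y ^ 2) ^ 2 + c = 0 := by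
    rw [hsq]
    linear_combination (-c * (P * V - U * Q + 1)) * hw
  have : ∀ N M : ℝ, (N * Y - M * (M / Y)) / Y ^ 2 + A * Y + c / Y ^ 3
      = (N * Y ^ 2 - M ^ 2 + A * (Y ^ 2) ^ 2 + c) / Y ^ 3 := by
    intro N M
    field_simp
  rw [this, key, zero_div]
end

section
/- Let $a_0, c \in \mathbb{R}$, let $I$ be an open interval containing $0$, and let $y : \mathbb{R} \to \mathbb{R}$ be twice differentiable on $I$ with $y(x) \neq 0$ for all $x \in I$, satisfying $y''(x) + a_0\,y(x) + \dfrac{c}{y(x)^3} = 0$ for all $x \in I$, with $y(0) = q$ and $y'(0) = p$ (so $q \neq 0$). Then the function $z(x) = y(x)^2$ is twice differentiable on $I$ and satisfies the linear equation $z''(x) + 4a_0\,z(x) = 2\left(p^2 + a_0 q^2 - \dfrac{c}{q^2}\right)$ for all $x \in I$, together with $z(0) = q^2$ and $z'(0) = 2pq$. -/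
/-- main remark of the paper: If `y` is a twice differentiable,
nonvanishing solution of Pinney's equation with constant coefficient
`y'' + a₀ * y + c / y ^ 3 = 0` on an open interval `I = Ioo α β` containing `0`, with
`y 0 = q` and `y' 0 = p` (so `q ≠ 0`), then `z = y ^ 2` is twice differentiable on `I`
and satisfies the linear equation `z'' + 4 * a₀ * z = 2 * (p ^ 2 + a₀ * q ^ 2 - c / q ^ 2)`
on `I`, together with `z 0 = q ^ 2` and `z' 0 = 2 * p * q`. -/
theorem stmt_6 (a₀ c q p α β : ℝ) (y y' y'' : ℝ → ℝ)
    (h0 : (0 : ℝ) ∈ Set.Ioo α β)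
    (hy1 : ∀ x ∈ Set.Ioo α β, HasDerivAt y (y' x) x)
    (hy2 : ∀ x ∈ Set.Ioo α β, HasDerivAt y' (y'' x) x)
    (hne : ∀ x ∈ Set.Ioo α β, y x ≠ 0)
    (hode : ∀ x ∈ Set.Ioo α β, y'' x + a₀ * y x + c / y x ^ 3 = 0)
    (hq : y 0 = q) (hp : y' 0 = p)
    (z : ℝ → ℝ) (hz : ∀ x, z x = y x ^ 2) :
    (∀ x ∈ Set.Ioo α β,
      DifferentiableAt ℝ z x ∧ DifferentiableAt ℝ (deriv z) x ∧
      deriv (deriv z) x + 4 * a₀ * z x = 2 * (p ^ 2 + a₀ * q ^ 2 - c / q ^ 2)) ∧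
    z 0 = q ^ 2 ∧ deriv z 0 = 2 * p * q := by
  have hzf : z = fun x => y x ^ 2 := funext hz
  have hz1 : ∀ x ∈ Set.Ioo α β, HasDerivAt z (2 * y x * y' x) x := by
    intro x hx
    rw [hzf]
    refine ((hy1 x hx).fun_pow 2).congr_deriv ?_
    norm_num
  have hz2 : ∀ x ∈ Set.Ioo α β,
      HasDerivAt (deriv z) (2 * y' x * y' x + 2 * y x * y'' x) x := by
    intro x hx
    have h : HasDerivAt (fun t => 2 * y t * y' t) (2 * y' x * y' x + 2 * y x * y'' x) x :=
      ((hy1 x hx).const_mul 2).fun_mul (hy2 x hx)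
    refine h.congr_of_eventuallyEq ?_
    filter_upwards [isOpen_Ioo.mem_nhds hx] with t ht
    exact (hz1 t ht).deriv
  have hE : ∀ x ∈ Set.Ioo α β,
      HasDerivAt (fun t => y' t ^ 2 + a₀ * y t ^ 2 - c / y t ^ 2) 0 x := by
    intro x hx
    have hn := hne x hx
    have h := (((hy2 x hx).fun_pow 2).fun_add (((hy1 x hx).fun_pow 2).const_mul a₀)).fun_sub
      ((hasDerivAt_const x c).fun_div ((hy1 x hx).fun_pow 2) (pow_ne_zero 2 hn))
    refine h.congr_deriv ?_
    have e : y'' x = -(a₀ * y x) - c / y x ^ 3 := by linarith [hode x hx]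
    rw [e]
    field_simp
    norm_num
    try ring
  have hconst : ∀ x ∈ Set.Ioo α β,
      y' x ^ 2 + a₀ * y x ^ 2 - c / y x ^ 2 = p ^ 2 + a₀ * q ^ 2 - c / q ^ 2 := by
    intro x hx
    have h := isOpen_Ioo.is_const_of_deriv_eq_zero isPreconnected_Ioo
      (fun t ht => (hE t ht).differentiableAt.differentiableWithinAt)
      (fun t ht => (hE t ht).deriv) hx h0
    simpa only [hq, hp] using h
  refine ⟨fun x hx => ⟨(hz1 x hx).differentiableAt, (hz2 x hx).differentiableAt, ?_⟩, ?_, ?_⟩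
  · rw [(hz2 x hx).deriv, hz, ← hconst x hx]
    have hn := hne x hx
    have e : y'' x = -(a₀ * y x) - c / y x ^ 3 := by linarith [hode x hx]
    rw [e]
    field_simp
    ring
  · rw [hz, hq]
  · rw [(hz1 0 h0).deriv, hq, hp]
    ring
end
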